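/- arXiv:1707.03096 — 2 statements merged into one kernel-verified Lean document; each statement's English description precedes it below -/
import Mathlib

section
/- For every real number b > 0 and every real number a ≠ 0, the symmetric improper integrals ∫_{-R}^{R} i·τ·e^{iaτ}/(b² + τ²) dτ converge as R → ∞, and lim_{R→∞} ∫_{-R}^{R} i·τ·e^{iaτ}/(b² + τ²) dτ = -π·e^{-b|a|}·sign(a), where sign(a) = 1 if a > 0 and sign(a) = -1 if a < 0. -/
open MeasureTheory Real Filter

/-- The function `z ↦ i z e^{iaz} + b e^{-ab}`, which vanishes at `i b`. -/
noncomputable def poleNumerator (b a : ℝ) (z : ℂ) : ℂ :=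
  Complex.I * z * Complex.exp (Complex.I * a * z) + b * Real.exp (-(a * b))

/-- The quotient of `poleNumerator b a` by `b ^ 2 + z ^ 2`, with the singularity at `i b` removed. -/
noncomputable def regularizedQuotient (b a : ℝ) (z : ℂ) : ℂ :=
  dslope (poleNumerator b a) (Complex.I * b) z / (z + Complex.I * b)

lemma poleNumerator_pole (b a : ℝ) : poleNumerator b a (Complex.I * b) = 0 := by
  have h : Complex.I * a * (Complex.I * b) = ((-(a * b) : ℝ) : ℂ) := by
    push_cast
    linear_combination (a * b : ℂ) * Complex.I_mul_I
  rw [poleNumerator, h, ← Complex.ofReal_exp]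
  linear_combination (b * (Real.exp (-(a * b)) : ℂ)) * Complex.I_mul_I

lemma differentiable_poleNumerator (b a : ℝ) : Differentiable ℂ (poleNumerator b a) := by
  unfold poleNumerator
  fun_prop

lemma regularizedQuotient_of_ne {b a : ℝ} {z : ℂ} (hz : z ≠ Complex.I * b) :
    regularizedQuotient b a z = poleNumerator b a z / ((b : ℂ) ^ 2 + z ^ 2) := by
  have h : (b : ℂ) ^ 2 + z ^ 2 = (z - Complex.I * b) * (z + Complex.I * b) := by
    linear_combination (b ^ 2 : ℂ) * Complex.I_mul_I
  rw [regularizedQuotient, dslope_of_ne _ hz, slope_def_field, poleNumerator_pole, sub_zero,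
    h, div_div]

lemma differentiableOn_regularizedQuotient {b : ℝ} (hb : 0 < b) (a : ℝ) :
    DifferentiableOn ℂ (regularizedQuotient b a) {z | 0 ≤ z.im} := by
  have h : Differentiable ℂ (dslope (poleNumerator b a) (Complex.I * b)) := by
    rw [← differentiableOn_univ, Complex.differentiableOn_dslope Filter.univ_mem]
    exact (differentiable_poleNumerator b a).differentiableOn
  refine h.differentiableOn.div (by fun_prop) fun z hz h0 => ?_
  have h1 := congrArg Complex.im h0
  simp at h1 hz
  linarith

lemma norm_regularizedQuotient_le {b a R : ℝ} (hb : 0 < b) (ha : 0 < a) (hR : 2 * b ≤ R) {z : ℂ}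
    (hz : R ≤ ‖z‖) :
    ‖regularizedQuotient b a z‖ ≤ 2 / R * Real.exp (-a * z.im) + 2 * b / R ^ 2 := by
  have hR0 : 0 < R := by linarith
  have hz0 : 0 < ‖z‖ := by linarith
  have hne : z ≠ Complex.I * b := by
    rintro rfl
    rw [norm_mul, Complex.norm_I, Complex.norm_real, Real.norm_eq_abs, abs_of_pos hb] at hz
    linarith
  have hnum : ‖poleNumerator b a z‖ ≤ ‖z‖ * Real.exp (-a * z.im) + b := by
    refine (norm_add_le _ _).trans (add_le_add (le_of_eq ?_) ?_)
    · simp [Complex.norm_exp]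
    · rw [norm_mul, Complex.norm_real, Complex.norm_real, Real.norm_eq_abs, Real.norm_eq_abs,
        abs_of_pos hb, Real.abs_exp]
      exact mul_le_of_le_one_right hb.le (Real.exp_le_one_iff.2 (by nlinarith))
  have hden : ‖z‖ ^ 2 / 2 ≤ ‖(b : ℂ) ^ 2 + z ^ 2‖ := by
    have h := norm_sub_norm_le (z ^ 2) (-(b : ℂ) ^ 2)
    rw [sub_neg_eq_add, norm_neg, norm_pow, norm_pow, Complex.norm_real, Real.norm_eq_abs, sq_abs,
      add_comm] at h
    nlinarith
  rw [regularizedQuotient_of_ne hne, norm_div]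
  calc _ ≤ (‖z‖ * Real.exp (-a * z.im) + b) / (‖z‖ ^ 2 / 2) := by gcongr
    _ = 2 / ‖z‖ * Real.exp (-a * z.im) + 2 * b / ‖z‖ ^ 2 := by field_simp
    _ ≤ _ := by gcongr

lemma norm_integral_regularizedQuotient_side_le {b a R x : ℝ} (hb : 0 < b) (ha : 0 < a)
    (hR : 2 * b ≤ R) (hx : R ≤ |x|) :
    ‖∫ y in (0 : ℝ)..R, regularizedQuotient b a (x + y * Complex.I)‖
      ≤ (2 / a + 2 * b) / R := by
  have hR0 : 0 < R := by linarith
  have hint : ∫ y in (0 : ℝ)..R, (2 / R * Real.exp (-a * y) + 2 * b / R ^ 2)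
      = 2 / R * ((1 - Real.exp (-a * R)) / a) + 2 * b / R := by
    rw [intervalIntegral.integral_add (Continuous.intervalIntegrable (by fun_prop) _ _)
      (by simp), intervalIntegral.integral_const_mul,
      intervalIntegral.integral_comp_mul_left (fun x => Real.exp x) (neg_ne_zero.2 ha.ne')]
    simp
    field_simp
    ring
  refine (intervalIntegral.norm_integral_le_of_norm_le (g := fun y =>
    2 / R * Real.exp (-a * y) + 2 * b / R ^ 2) hR0.le (.of_forall fun y hy => ?_)
    (Continuous.intervalIntegrable (by fun_prop) _ _)).trans ?_
  · have h := norm_regularizedQuotient_le (z := x + y * Complex.I) hb ha hR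
      (hx.trans (by simpa using Complex.abs_re_le_norm (x + y * Complex.I)))
    simpa using h
  · rw [hint]
    have := Real.exp_pos (-a * R)
    calc _ ≤ 2 / R * (1 / a) + 2 * b / R := by gcongr; linarith
      _ = _ := by field_simp

lemma norm_integral_regularizedQuotient_top_le {b a R : ℝ} (hb : 0 < b) (ha : 0 < a)
    (hR : 2 * b ≤ R) :
    ‖∫ x in (-R)..R, regularizedQuotient b a (x + R * Complex.I)‖
      ≤ (4 / a + 4 * b) / R := by
  have hR0 : 0 < R := by linarith
  have hexp : Real.exp (-a * R) ≤ 1 / (a * R) := by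
    rw [neg_mul, Real.exp_neg, ← one_div]
    have := Real.add_one_le_exp (a * R)
    gcongr
    linarith
  refine (intervalIntegral.norm_integral_le_of_norm_le_const
    (C := 2 / R * (1 / (a * R)) + 2 * b / R ^ 2) fun x _ => ?_).trans (le_of_eq ?_)
  · have h := norm_regularizedQuotient_le (z := x + R * Complex.I) hb ha hR
      ((le_abs_self R).trans (by simpa using Complex.abs_im_le_norm (x + R * Complex.I)))
    refine h.trans ?_
    simp only [Complex.add_im, Complex.ofReal_im, Complex.mul_im, Complex.ofReal_re, Complex.I_im,
      Complex.I_re, mul_one, mul_zero, add_zero, zero_add]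
    gcongr
  · rw [sub_neg_eq_add, abs_of_pos (by linarith)]
    field_simp
    ring

lemma tendsto_integral_regularizedQuotient {b a : ℝ} (hb : 0 < b) (ha : 0 < a) :
    Tendsto (fun R : ℝ => ∫ τ in (-R)..R, regularizedQuotient b a τ) atTop (nhds 0) := by
  refine squeeze_zero_norm' (a := fun R => (8 / a + 8 * b) / R) ?_
    (tendsto_const_nhds.div_atTop tendsto_id)
  filter_upwards [eventually_ge_atTop (2 * b)] with R hR
  have hR0 : 0 < R := by linarith
  have hC := Complex.integral_boundary_rect_eq_zero_of_differentiableOn (regularizedQuotient b a)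
    (-R : ℝ) (R + R * Complex.I) ((differentiableOn_regularizedQuotient hb a).mono fun z hz => by
      have h := hz.2
      simp [Set.uIcc_of_le hR0.le] at h
      exact h.1)
  simp only [Complex.ofReal_re, Complex.ofReal_im, Complex.add_re, Complex.add_im, Complex.mul_re,
    Complex.mul_im, Complex.I_re, Complex.I_im, mul_one, mul_zero, add_zero, zero_add, sub_zero,
    zero_mul, Complex.ofReal_zero, smul_eq_mul] at hC
  have h1 := norm_integral_regularizedQuotient_side_le (x := R) hb ha hR (le_abs_self R)
  have h2 := norm_integral_regularizedQuotient_side_le (x := -R) hb ha hR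
    (by rw [abs_neg]; exact le_abs_self R)
  have h3 := norm_integral_regularizedQuotient_top_le hb ha hR
  set A := ∫ y in (0 : ℝ)..R, regularizedQuotient b a (R + y * Complex.I)
  set B := ∫ y in (0 : ℝ)..R, regularizedQuotient b a ((-R : ℝ) + y * Complex.I)
  set T := ∫ x in (-R)..R, regularizedQuotient b a (x + R * Complex.I)
  have key : ∫ τ in (-R)..R, regularizedQuotient b a τ = T - Complex.I * A + Complex.I * B := by
    linear_combination hC
  rw [key]
  calc _ ≤ ‖T‖ + ‖A‖ + ‖B‖ := by
        refine (norm_add_le _ _).trans (add_le_add ((norm_sub_le _ _).trans ?_) ?_) <;> simp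
    _ ≤ (4 / a + 4 * b) / R + (2 / a + 2 * b) / R + (2 / a + 2 * b) / R := by gcongr
    _ = _ := by ring

lemma tendsto_integral_div_sq_add_sq {b : ℝ} (hb : 0 < b) :
    Tendsto (fun R : ℝ => ∫ τ in (-R)..R, b / (b ^ 2 + τ ^ 2)) atTop (nhds π) := by
  have h (R : ℝ) : ∫ τ in (-R)..R, b / (b ^ 2 + τ ^ 2) = 2 * Real.arctan (R / b) := by
    rw [integral_div_sq_add_sq, neg_div, Real.arctan_neg]
    ring
  simp_rw [h]
  have := ((Real.tendsto_arctan_atTop.mono_right nhdsWithin_le_nhds).comp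
    (tendsto_id.atTop_div_const hb)).const_mul 2
  rwa [mul_div_cancel₀ _ two_ne_zero] at this

lemma tendsto_integral_of_pos {b a : ℝ} (hb : 0 < b) (ha : 0 < a) :
    Tendsto (fun R : ℝ => ∫ τ in (-R)..R,
        Complex.I * τ * Complex.exp (Complex.I * a * τ) / ((b : ℂ) ^ 2 + (τ : ℂ) ^ 2))
      atTop (nhds (-(π * Real.exp (-(a * b)) : ℝ) : ℂ)) := by
  have hden (τ : ℝ) : (b : ℂ) ^ 2 + (τ : ℂ) ^ 2 ≠ 0 := by
    norm_cast
    positivity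
  have hlim := (tendsto_integral_regularizedQuotient hb ha).sub
    ((Complex.continuous_ofReal.tendsto _).comp
      ((tendsto_integral_div_sq_add_sq hb).mul_const (Real.exp (-(a * b)))))
  rw [zero_sub] at hlim
  refine hlim.congr fun R => ?_
  simp only [Function.comp_apply]
  rw [← intervalIntegral.integral_mul_const, ← intervalIntegral.integral_ofReal,
    ← intervalIntegral.integral_sub]
  · refine intervalIntegral.integral_congr fun τ _ => ?_
    have hne : (τ : ℂ) ≠ Complex.I * b := fun h => by
      have := congrArg Complex.im h
      simp at this
      exact hb.ne this
    simp only [regularizedQuotient_of_ne hne, poleNumerator]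
    push_cast
    have := hden τ
    field_simp
    ring
  · refine ((differentiableOn_regularizedQuotient hb a).continuousOn.comp_continuous
      Complex.continuous_ofReal fun x => ?_).intervalIntegrable _ _
    simp
  · refine Continuous.intervalIntegrable ?_ _ _
    have (τ : ℝ) : b ^ 2 + τ ^ 2 ≠ 0 := by positivity
    fun_prop (disch := assumption)

/-- For every real `b > 0` and every real `a ≠ 0`, the symmetric improper integrals
`∫_{-R}^{R} i·τ·e^{iaτ}/(b² + τ²) dτ` converge as `R → ∞` to
`-π·e^{-b|a|}·sign(a)`, where `sign(a) = 1` if `a > 0` and `-1` if `a < 0`. -/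
theorem stmt_1 (b a : ℝ) (hb : 0 < b) (ha : a ≠ 0) :
    Tendsto (fun R : ℝ =>
        ∫ τ in (-R)..R,
          Complex.I * τ * Complex.exp (Complex.I * a * τ) / ((b : ℂ) ^ 2 + (τ : ℂ) ^ 2))
      atTop
      (nhds ((-(π * Real.exp (-b * |a|) * (if 0 < a then 1 else -1)) : ℝ) : ℂ)) := by
  rcases ha.lt_or_gt with h | h
  · have hlim := (tendsto_integral_of_pos hb (neg_pos.2 h)).neg
    rw [if_neg h.not_gt, abs_of_neg h]
    convert hlim using 2 with R
    · rw [← intervalIntegral.integral_neg]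
      conv_lhs => rw [← neg_neg R, ← intervalIntegral.integral_comp_neg, neg_neg]
      refine intervalIntegral.integral_congr fun τ _ => ?_
      simp [neg_div]
    · push_cast
      ring_nf
  · have hlim := tendsto_integral_of_pos hb h
    rw [if_pos h, abs_of_pos h]
    convert hlim using 2
    push_cast
    ring_nf
end

section
/- Let m ≥ 1 and n be natural numbers, let j ∈ {1, …, m}, and let d > 0 be a real number. Then there exists a constant C > 0 such that for every ξ ∈ ℝ^m with ξ ≠ 0, the n-th iterated Fréchet derivative at ξ of the function k : ℝ^m \ {0} → ℝ, k(ξ) = ξ_j/(‖ξ‖·(1 + e^{-2d‖ξ‖})), satisfies ‖D^n k(ξ)‖ ≤ C·‖ξ‖^{-n}. -/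
open Set
open scoped ContDiff Nat

theorem uniqueDiffOn_compl_zero {E : Type*} [NormedAddCommGroup E] [NormedSpace ℝ E] :
    UniqueDiffOn ℝ ({0}ᶜ : Set E) :=
  isOpen_compl_singleton.uniqueDiffOn

/-- A family of bounds indexed by `ℕ` has a common nonnegative bound on each initial segment. -/
theorem exists_nonneg_forall_le_of_forall (c : ℕ → ℝ) (n : ℕ) :
    ∃ A, 0 ≤ A ∧ ∀ i ≤ n, c i ≤ A := by
  refine ⟨∑ i ∈ Finset.range (n + 1), |c i|, by positivity, fun i hi => ?_⟩
  exact (le_abs_self _).trans (Finset.single_le_sum (f := fun i => |c i|)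
    (fun _ _ => abs_nonneg _) (Finset.mem_range.2 (by omega)))

/-- `f` is smooth away from the origin and its `n`-th derivative is `O(‖x‖ ^ (p - n))`, uniformly
in `x ≠ 0`. -/
structure IsSymbol {E : Type*} [NormedAddCommGroup E] [NormedSpace ℝ E] (p : ℕ) (f : E → ℝ) :
    Prop where
  contDiffOn : ContDiffOn ℝ ∞ f {0}ᶜ
  bound : ∀ n : ℕ, ∃ C, ∀ x : E, x ≠ 0 →
    ‖iteratedFDerivWithin ℝ n f {0}ᶜ x‖ ≤ C * ‖x‖ ^ p * ‖x‖⁻¹ ^ n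

namespace IsSymbol

variable {E : Type*} [NormedAddCommGroup E] [NormedSpace ℝ E]

theorem exists_uniform_bound {p : ℕ} {f : E → ℝ} (hf : IsSymbol p f) (n : ℕ) :
    ∃ A, 0 ≤ A ∧ ∀ i ≤ n, ∀ x : E, x ≠ 0 →
      ‖iteratedFDerivWithin ℝ i f {0}ᶜ x‖ ≤ A * ‖x‖ ^ p * ‖x‖⁻¹ ^ i := by
  choose c hc using hf.bound
  obtain ⟨A, hA, h⟩ := exists_nonneg_forall_le_of_forall c n
  refine ⟨A, hA, fun i hi x hx => (hc i x hx).trans ?_⟩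
  gcongr
  exact h i hi

/-- Smooth functions that are positively homogeneous of degree `p` are symbols of order `p`. -/
theorem of_homogeneous [FiniteDimensional ℝ E] {p : ℕ} {f : E → ℝ}
    (hf : ContDiffOn ℝ ∞ f {0}ᶜ)
    (hom : ∀ c : ℝ, 0 < c → ∀ x : E, x ≠ 0 → f (c • x) = c ^ p * f x) : IsSymbol p f := by
  refine ⟨hf, fun n => ?_⟩
  have : ProperSpace E := FiniteDimensional.proper ℝ E
  have hcont : ContinuousOn (iteratedFDerivWithin ℝ n f {0}ᶜ) (Metric.sphere (0 : E) 1) :=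
    (hf.continuousOn_iteratedFDerivWithin (by exact_mod_cast le_top)
      uniqueDiffOn_compl_zero).mono fun x hx => by
        rintro rfl
        simp at hx
  obtain ⟨C, hC⟩ := (isCompact_sphere (0 : E) 1).exists_bound_of_continuousOn hcont
  refine ⟨C, fun x hx => ?_⟩
  have hx0 : 0 < ‖x‖ := norm_pos_iff.2 hx
  -- compare `f` with `f ∘ (‖x‖ • ·)` at the unit vector `x / ‖x‖`
  set c : ℝ := ‖x‖⁻¹ with hc
  have hc0 : 0 < c := inv_pos.2 hx0
  have hy : c • x ∈ Metric.sphere (0 : E) 1 := by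
    simp [norm_smul, hc, hx0.ne']
  have hCy := hC _ hy
  have hcx : c • x ≠ 0 := smul_ne_zero hc0.ne' hx
  let g : E →L[ℝ] E := c • ContinuousLinearMap.id ℝ E
  have hg : ‖g‖ ≤ c := by
    refine ContinuousLinearMap.opNorm_le_bound _ hc0.le fun y => ?_
    simp [g, norm_smul, abs_of_pos hc0]
  have hpre : g ⁻¹' {0}ᶜ = {0}ᶜ := by
    ext y
    simp [g, hc0.ne']
  have h1 := g.iteratedFDerivWithin_comp_right (i := n) (x := x) hf uniqueDiffOn_compl_zero
    (by rw [hpre]; exact uniqueDiffOn_compl_zero) (by simpa [g] using hcx)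
    (by exact_mod_cast le_top)
  rw [hpre] at h1
  have h2 : iteratedFDerivWithin ℝ n (f ∘ g) {0}ᶜ x =
      c ^ p • iteratedFDerivWithin ℝ n f {0}ᶜ x := by
    rw [← iteratedFDerivWithin_const_smul_apply
      ((hf x hx).of_le (by exact_mod_cast le_top)) uniqueDiffOn_compl_zero hx]
    refine iteratedFDerivWithin_congr (fun y hy => ?_) hx n
    simpa [g] using hom c hc0 y hy
  have h3 : c ^ p * ‖iteratedFDerivWithin ℝ n f {0}ᶜ x‖ ≤ C * c ^ n := by
    calc c ^ p * ‖iteratedFDerivWithin ℝ n f {0}ᶜ x‖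
        = ‖c ^ p • iteratedFDerivWithin ℝ n f {0}ᶜ x‖ := by
          rw [norm_smul, Real.norm_of_nonneg (by positivity)]
      _ ≤ ‖iteratedFDerivWithin ℝ n f {0}ᶜ (g x)‖ * ∏ _i : Fin n, ‖g‖ := by
          rw [← h2, h1]
          exact ContinuousMultilinearMap.norm_compContinuousLinearMap_le _ _
      _ ≤ C * c ^ n := by
          rw [Finset.prod_const, Finset.card_univ, Fintype.card_fin]
          have hC0 : 0 ≤ C := (norm_nonneg _).trans hCy
          gcongr
          exact hCy
  have h4 : ‖x‖ ^ p * c ^ p = 1 := by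
    rw [← mul_pow, hc, mul_inv_cancel₀ hx0.ne', one_pow]
  calc ‖iteratedFDerivWithin ℝ n f {0}ᶜ x‖
      = ‖x‖ ^ p * (c ^ p * ‖iteratedFDerivWithin ℝ n f {0}ᶜ x‖) := by
        rw [← mul_assoc, h4, one_mul]
    _ ≤ ‖x‖ ^ p * (C * c ^ n) := by gcongr
    _ = C * ‖x‖ ^ p * c ^ n := by ring

/-- The product of two symbols is a symbol. -/
theorem mul {p q : ℕ} {f g : E → ℝ} (hf : IsSymbol p f) (hg : IsSymbol q g) :
    IsSymbol (p + q) (fun x => f x * g x) := by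
  refine ⟨hf.contDiffOn.mul hg.contDiffOn, fun n => ?_⟩
  obtain ⟨A, hA, hfA⟩ := hf.exists_uniform_bound n
  obtain ⟨B, hB, hgB⟩ := hg.exists_uniform_bound n
  refine ⟨∑ i ∈ Finset.range (n + 1), (n.choose i : ℝ) * A * B, fun x hx => ?_⟩
  refine (norm_iteratedFDerivWithin_mul_le hf.contDiffOn hg.contDiffOn uniqueDiffOn_compl_zero
    hx (by exact_mod_cast le_top)).trans ?_
  rw [Finset.sum_mul, Finset.sum_mul]
  refine Finset.sum_le_sum fun i hi => ?_
  have hin : i ≤ n := by simpa [Nat.lt_succ_iff] using hi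
  calc _ ≤ (n.choose i : ℝ) * (A * ‖x‖ ^ p * ‖x‖⁻¹ ^ i) *
        (B * ‖x‖ ^ q * ‖x‖⁻¹ ^ (n - i)) := by
        gcongr
        · exact hfA i hin x hx
        · exact hgB (n - i) (by omega) x hx
    _ = (n.choose i : ℝ) * A * B * ‖x‖ ^ (p + q) * (‖x‖⁻¹ ^ i * ‖x‖⁻¹ ^ (n - i)) := by ring
    _ = _ := by rw [← pow_add, Nat.add_sub_cancel' hin]

/-- Composing a symbol of order zero with values in a compact set with a function that is smooth
near that set gives a symbol of order zero. -/
theorem comp {f : E → ℝ} (hf : IsSymbol 0 f) {g : ℝ → ℝ} {t K : Set ℝ} (ht : IsOpen t)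
    (hg : ContDiffOn ℝ ∞ g t) (hK : IsCompact K) (hKt : K ⊆ t) (hfK : MapsTo f {0}ᶜ K) :
    IsSymbol 0 (g ∘ f) := by
  refine ⟨hg.comp hf.contDiffOn (hfK.mono_right hKt), fun n => ?_⟩
  obtain ⟨A, hA, hfA⟩ := hf.exists_uniform_bound n
  have hgK : ∀ i : ℕ, ∃ c, ∀ y ∈ K, ‖iteratedFDerivWithin ℝ i g t y‖ ≤ c := fun i =>
    hK.exists_bound_of_continuousOn ((hg.continuousOn_iteratedFDerivWithin
      (by exact_mod_cast le_top) ht.uniqueDiffOn).mono hKt)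
  choose c hc using hgK
  obtain ⟨B, hB, hcB⟩ := exists_nonneg_forall_le_of_forall c n
  refine ⟨n ! * B * (1 + A) ^ n, fun x hx => ?_⟩
  refine (norm_iteratedFDerivWithin_comp_le (C := B) (D := (1 + A) * ‖x‖⁻¹) hg hf.contDiffOn
    (by exact_mod_cast le_top) ht.uniqueDiffOn uniqueDiffOn_compl_zero (hfK.mono_right hKt) hx
    (fun i hi => (hc i _ (hfK hx)).trans (hcB i hi)) fun i hi hin => ?_).trans_eq
      (by rw [mul_pow]; ring)
  refine (hfA i hin x hx).trans ?_
  rw [mul_pow, pow_zero, mul_one]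
  gcongr
  exact (by linarith : A ≤ 1 + A).trans (le_self_pow₀ (by linarith) (by omega))

end IsSymbol

/-- Exponential decay beats polynomial growth, with explicit constants. -/
theorem one_add_mul_pow_mul_exp_neg_bounded {A c : ℝ} (hA : 0 ≤ A) (hc : 0 < c) (n : ℕ) :
    ∃ B, ∀ r : ℝ, 0 ≤ r → (1 + A * r) ^ n * Real.exp (-c * r) ≤ B := by
  set b := c / (A + 1) with hb
  have hb0 : 0 < b := by positivity
  have hbA : b * A ≤ c := by
    rw [hb, div_mul_eq_mul_div, div_le_iff₀ (by positivity)]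
    nlinarith
  refine ⟨n ! / b ^ n * Real.exp b, fun r hr => ?_⟩
  have h := Real.pow_div_factorial_le_exp (x := b * (1 + A * r)) (by positivity) n
  rw [div_le_iff₀ (by positivity), mul_pow] at h
  have h1 : (1 + A * r) ^ n ≤ n ! / b ^ n * Real.exp (b * (1 + A * r)) := by
    rw [div_mul_eq_mul_div, le_div_iff₀ (by positivity)]
    linarith
  calc (1 + A * r) ^ n * Real.exp (-c * r)
      ≤ n ! / b ^ n * Real.exp (b * (1 + A * r)) * Real.exp (-c * r) := by gcongr
    _ = n ! / b ^ n * Real.exp (b * (1 + A * r) + -c * r) := by rw [mul_assoc, Real.exp_add]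
    _ ≤ n ! / b ^ n * Real.exp b := by
        gcongr
        nlinarith [mul_le_mul_of_nonneg_right hbA hr]

section InnerProductSpace

variable {E : Type*} [NormedAddCommGroup E] [InnerProductSpace ℝ E]

theorem contDiffOn_norm_compl_zero : ContDiffOn ℝ ∞ (fun x : E => ‖x‖) {0}ᶜ :=
  fun _ hx => (contDiffAt_norm ℝ hx).contDiffWithinAt

variable [FiniteDimensional ℝ E]

theorem isSymbol_exp_neg_mul_norm {c : ℝ} (hc : 0 < c) :
    IsSymbol 0 (fun x : E => Real.exp (-c * ‖x‖)) := by
  have hf : IsSymbol 1 (fun x : E => -c * ‖x‖) :=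
    .of_homogeneous (contDiffOn_const.mul contDiffOn_norm_compl_zero) fun a ha x _ => by
      rw [norm_smul, Real.norm_of_nonneg ha.le]
      ring
  refine ⟨Real.contDiff_exp.comp_contDiffOn hf.contDiffOn, fun n => ?_⟩
  obtain ⟨A, hA, hfA⟩ := hf.exists_uniform_bound n
  obtain ⟨B, hB⟩ := one_add_mul_pow_mul_exp_neg_bounded hA hc n
  refine ⟨n ! * B, fun x hx => ?_⟩
  have h := norm_iteratedFDerivWithin_comp_le (n := n) (x := x) (C := Real.exp (-c * ‖x‖))
    (D := (1 + A * ‖x‖) * ‖x‖⁻¹) Real.contDiff_exp.contDiffOn hf.contDiffOn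
    (by exact_mod_cast le_top) uniqueDiffOn_univ uniqueDiffOn_compl_zero (mapsTo_univ _ _) hx
    (fun i _ => by
      rw [iteratedFDerivWithin_univ, norm_iteratedFDeriv_eq_norm_iteratedDeriv,
        iteratedDeriv_eq_iterate, Real.iter_deriv_exp, Real.norm_of_nonneg (Real.exp_pos _).le])
    (fun i hi hin => by
      refine (hfA i hin x hx).trans ?_
      rw [mul_pow, pow_one]
      have h0 : 0 ≤ A * ‖x‖ := by positivity
      gcongr
      exact (by linarith : A * ‖x‖ ≤ 1 + A * ‖x‖).trans
        (le_self_pow₀ (by linarith) (by omega)))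
  refine h.trans ?_
  calc n ! * Real.exp (-c * ‖x‖) * ((1 + A * ‖x‖) * ‖x‖⁻¹) ^ n
      = n ! * ((1 + A * ‖x‖) ^ n * Real.exp (-c * ‖x‖)) * ‖x‖ ^ 0 * ‖x‖⁻¹ ^ n := by
        rw [mul_pow]; ring
    _ ≤ n ! * B * ‖x‖ ^ 0 * ‖x‖⁻¹ ^ n := by
      gcongr
      exact hB _ (norm_nonneg x)

theorem isSymbol_inv_one_add_exp_neg_mul_norm {c : ℝ} (hc : 0 < c) :
    IsSymbol 0 (fun x : E => (1 + Real.exp (-c * ‖x‖))⁻¹) := by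
  refine (isSymbol_exp_neg_mul_norm hc).comp (g := fun u => (1 + u)⁻¹) (t := Ioi (-1))
    (K := Icc 0 1) isOpen_Ioi ?_ isCompact_Icc (fun u hu => ?_) fun x _ => ?_
  · refine (contDiffOn_const.add contDiffOn_id).inv fun u hu => ?_
    have : -1 < u := hu
    simp only [id]
    linarith
  · have := hu.1
    simp only [mem_Ioi]
    linarith
  · refine ⟨(Real.exp_pos _).le, Real.exp_le_one_iff.2 ?_⟩
    have := mul_nonneg hc.le (norm_nonneg x)
    linarith

theorem isSymbol_clm_div_norm (l : E →L[ℝ] ℝ) : IsSymbol 0 (fun x : E => l x / ‖x‖) :=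
  .of_homogeneous
    (l.contDiff.contDiffOn.div contDiffOn_norm_compl_zero fun _ hx => norm_ne_zero_iff.2 hx)
    fun a ha x _ => by
      rw [norm_smul, Real.norm_of_nonneg ha.le, map_smul, smul_eq_mul, pow_zero, one_mul,
        mul_div_mul_left _ _ ha.ne']

end InnerProductSpace

/-- Combined Leibniz-rule symbol estimate for `ξ ↦ ξ_j/(‖ξ‖·(1 + e^{-2d‖ξ‖}))`:
there is `C > 0` such that for every `ξ ≠ 0`, `‖D^n k(ξ)‖ ≤ C·‖ξ‖^{-n}`. -/
theorem stmt_5 (m n : ℕ) (hm : 1 ≤ m) (j : Fin m) (d : ℝ) (hd : 0 < d) :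
    ∃ C > 0, ∀ ξ : EuclideanSpace ℝ (Fin m), ξ ≠ 0 →
      ‖iteratedFDeriv ℝ n
          (fun ξ : EuclideanSpace ℝ (Fin m) =>
            ξ j / (‖ξ‖ * (1 + Real.exp (-2 * d * ‖ξ‖)))) ξ‖ ≤
        C * ‖ξ‖ ^ (-(n : ℤ)) := by
  have hk := (isSymbol_clm_div_norm (EuclideanSpace.proj (𝕜 := ℝ) j)).mul
    (isSymbol_inv_one_add_exp_neg_mul_norm (mul_pos two_pos hd))
  have heq : (fun ξ : EuclideanSpace ℝ (Fin m) =>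
      ξ j / (‖ξ‖ * (1 + Real.exp (-2 * d * ‖ξ‖)))) =
      fun ξ => EuclideanSpace.proj (𝕜 := ℝ) j ξ / ‖ξ‖ * (1 + Real.exp (-(2 * d) * ‖ξ‖))⁻¹ := by
    funext ξ
    rw [← div_eq_mul_inv, div_div, neg_mul 2 d]
    rfl
  obtain ⟨A, hA, h⟩ := hk.exists_uniform_bound n
  refine ⟨A + 1, by positivity, fun ξ hξ => ?_⟩
  rw [heq, ← iteratedFDerivWithin_of_isOpen n isOpen_compl_singleton hξ]
  refine (h n le_rfl ξ hξ).trans ?_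
  rw [zpow_neg, zpow_natCast, inv_pow, add_zero, pow_zero, mul_one]
  gcongr
  linarith
end
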